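/- Let G be a DD₂-graph on n vertices, let H* be a minimal spanning DD₂-subgraph of G of maximum number of edges, and let H be any minimal spanning DD₂-subgraph of G. Then |E(H*)| < 2n and consequently |E(H*)| < 3·|E(H)|. (Hence any minimal spanning DD₂-subgraph is a factor-3 approximation for the maximum-size minimal spanning DD₂-subgraph problem.) -/

import Mathlib

/-- `D` is a dominating set of `G`: every vertex outside `D` has a neighbor in `D`. -/
def Dominating {V : Type*} (G : SimpleGraph V) (D : Set V) : Prop :=
  ∀ v ∉ D, ∃ u ∈ D, G.Adj u v

/-- `D` is a 2-dominating set of `G`: every vertex outside `D` has at least two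
neighbors in `D`. -/
def TwoDominating {V : Type*} (G : SimpleGraph V) (D : Set V) : Prop :=
  ∀ v ∉ D, ∃ u ∈ D, ∃ w ∈ D, u ≠ w ∧ G.Adj u v ∧ G.Adj w v

/-- `G` is a `DD₂`-graph: there are disjoint sets `D`, `D₂` such that `D` is dominating
and `D₂` is 2-dominating. -/
def IsDD2 {V : Type*} (G : SimpleGraph V) : Prop :=
  ∃ D D2 : Set V, Disjoint D D2 ∧ Dominating G D ∧ TwoDominating G D2

/-- `G` is a minimal `DD₂`-graph: `G` is a `DD₂`-graph and no proper spanning subgraph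
of `G` is a `DD₂`-graph.  (For disconnected graphs this is equivalent to every connected
component being a minimal `DD₂`-graph.) -/
def MinimalDD2 {V : Type*} (G : SimpleGraph V) : Prop :=
  IsDD2 G ∧ ∀ H : SimpleGraph V, H < G → ¬ IsDD2 H

/-- A `DD₂`-graph has a vertex set `D` such that every vertex of `D` has two neighbors outside
`D` and every other vertex has a neighbor in `D`; the neighbors are given by functions. -/
theorem IsDD2.exists_choice {V : Type*} {G : SimpleGraph V} (hG : IsDD2 G) :
    ∃ (D : Set V) (a b : V → V), (∀ v, G.Adj v (a v)) ∧ (∀ v ∈ D, a v ∉ D) ∧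
      (∀ v ∉ D, a v ∈ D) ∧ (∀ v ∈ D, G.Adj v (b v)) ∧ (∀ v ∈ D, b v ∉ D) ∧
      ∀ v ∈ D, a v ≠ b v := by
  obtain ⟨D, D2, hd, h1, h2⟩ := hG
  have key : ∀ v, ∃ p : V × V, G.Adj v p.1 ∧ (v ∈ D → p.1 ∉ D) ∧ (v ∉ D → p.1 ∈ D) ∧
      (v ∈ D → G.Adj v p.2) ∧ (v ∈ D → p.2 ∉ D) ∧ (v ∈ D → p.1 ≠ p.2) := by
    intro v
    by_cases hv : v ∈ D
    · obtain ⟨u, hu, w, hw, hne, hau, haw⟩ := h2 v (Set.disjoint_left.mp hd hv)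
      exact ⟨(u, w), hau.symm, fun _ => Set.disjoint_right.mp hd hu, fun h => absurd hv h,
        fun _ => haw.symm, fun _ => Set.disjoint_right.mp hd hw, fun _ => hne⟩
    · obtain ⟨u, hu, hau⟩ := h1 v hv
      exact ⟨(u, u), hau.symm, fun h => absurd h hv, fun _ => hu, fun h => absurd h hv,
        fun h => absurd h hv, fun h => absurd h hv⟩
  choose p hp using key
  exact ⟨D, fun v => (p v).1, fun v => (p v).2, fun v => (hp v).1, fun v => (hp v).2.1,
    fun v => (hp v).2.2.1, fun v => (hp v).2.2.2.1, fun v => (hp v).2.2.2.2.1,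
    fun v => (hp v).2.2.2.2.2⟩

/-- If `f` maps every vertex of `A` outside `A`, the edges `{v, f v}` with `v ∈ A` are distinct. -/
theorem injOn_sym2_mk_of_notMem {V : Type*} {A : Set V} {f : V → V} (hf : ∀ v ∈ A, f v ∉ A) :
    Set.InjOn (fun v => s(v, f v)) A := by
  intro v hv w hw h
  rcases Sym2.eq_iff.mp h with h | h
  · exact h.1
  · exact absurd (h.1 ▸ hv) (hf w hw)

theorem MinimalDD2.ncard_edgeSet_lt {V : Type*} [Fintype V] [Nonempty V] {G : SimpleGraph V}
    (hG : MinimalDD2 G) : G.edgeSet.ncard < 2 * Fintype.card V := by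
  obtain ⟨D, a, b, ha, haD, haD', hb, hbD, hab⟩ := hG.1.exists_choice
  let S : Set (Sym2 V) := Set.range (fun v => s(v, a v)) ∪ (fun v => s(v, b v)) '' D
  have hle : SimpleGraph.fromEdgeSet S ≤ G := by
    intro x y hxy
    rw [SimpleGraph.fromEdgeSet_adj] at hxy
    rw [← SimpleGraph.mem_edgeSet]
    rcases hxy.1 with ⟨v, hv⟩ | ⟨v, hvD, hv⟩
    · exact hv ▸ ha v
    · exact hv ▸ hb v hvD
  have hKa : ∀ v, (SimpleGraph.fromEdgeSet S).Adj (a v) v := fun v =>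
    ((SimpleGraph.fromEdgeSet_adj S).mpr ⟨Or.inl ⟨v, rfl⟩, (ha v).ne⟩).symm
  have hKb : ∀ v ∈ D, (SimpleGraph.fromEdgeSet S).Adj (b v) v := fun v hv =>
    ((SimpleGraph.fromEdgeSet_adj S).mpr ⟨Or.inr ⟨v, hv, rfl⟩, (hb v hv).ne⟩).symm
  have hK : IsDD2 (SimpleGraph.fromEdgeSet S) := by
    refine ⟨D, Dᶜ, disjoint_compl_right, fun v hv => ⟨a v, haD' v hv, hKa v⟩, fun v hv => ?_⟩
    have hv' : v ∈ D := not_not.mp hv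
    exact ⟨a v, haD v hv', b v, hbD v hv', hab v hv', hKa v, hKb v hv'⟩
  have heq : SimpleGraph.fromEdgeSet S = G := by
    by_contra hne
    exact hG.2 _ (lt_of_le_of_ne hle hne) hK
  have hsub : G.edgeSet ⊆ S := by
    rw [← heq, SimpleGraph.edgeSet_fromEdgeSet]
    exact Set.sdiff_subset
  have hDne : D ≠ Set.univ := by
    rintro rfl
    obtain ⟨v⟩ := ‹Nonempty V›
    exact haD v trivial trivial
  have hD : D.ncard < Fintype.card V := by
    rw [← Nat.card_eq_fintype_card]
    exact Set.ncard_lt_card hDne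
  have hrange : (Set.range fun v => s(v, a v)).ncard ≤ Fintype.card V := by
    rw [← Set.image_univ, ← Nat.card_eq_fintype_card, ← Set.ncard_univ]
    exact Set.ncard_image_le
  calc G.edgeSet.ncard ≤ S.ncard := Set.ncard_le_ncard hsub
    _ ≤ _ := Set.ncard_union_le _ _
    _ ≤ Fintype.card V + D.ncard := Nat.add_le_add hrange Set.ncard_image_le
    _ < 2 * Fintype.card V := by omega

theorem IsDD2.two_mul_card_le {V : Type*} [Fintype V] {G : SimpleGraph V} (hG : IsDD2 G) :
    2 * Fintype.card V ≤ 3 * G.edgeSet.ncard := by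
  obtain ⟨D, a, b, ha, haD, haD', hb, hbD, hab⟩ := hG.exists_choice
  have hdisj : Disjoint ((fun v => s(v, a v)) '' D) ((fun v => s(v, b v)) '' D) := by
    rw [Set.disjoint_left]
    rintro _ ⟨v, hv, rfl⟩ ⟨w, hw, h⟩
    rcases Sym2.eq_iff.mp h with ⟨rfl, h⟩ | ⟨rfl, -⟩
    · exact hab w hw h.symm
    · exact haD v hv hw
  have hD : D.ncard + D.ncard ≤ G.edgeSet.ncard := by
    calc D.ncard + D.ncard
        = ((fun v => s(v, a v)) '' D ∪ (fun v => s(v, b v)) '' D).ncard := by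
          rw [Set.ncard_union_eq hdisj, (injOn_sym2_mk_of_notMem haD).ncard_image,
            (injOn_sym2_mk_of_notMem hbD).ncard_image]
      _ ≤ G.edgeSet.ncard := by
          refine Set.ncard_le_ncard (Set.union_subset ?_ ?_)
          · exact Set.image_subset_iff.mpr fun v _ => ha v
          · exact Set.image_subset_iff.mpr fun v hv => hb v hv
  have hDc : Dᶜ.ncard ≤ G.edgeSet.ncard := by
    rw [← (injOn_sym2_mk_of_notMem (A := Dᶜ) fun v hv h => h (haD' v hv)).ncard_image]
    exact Set.ncard_le_ncard (Set.image_subset_iff.mpr fun v _ => ha v)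
  have hcard := Set.ncard_add_ncard_compl D
  rw [Nat.card_eq_fintype_card] at hcard
  omega

/-- If `G` is a `DD₂`-graph on `n` vertices, `Hstar` is a minimal
spanning `DD₂`-subgraph of `G` with the maximum number of edges and `H` is any minimal
spanning `DD₂`-subgraph of `G`, then `|E(Hstar)| < 2n` and `|E(Hstar)| < 3|E(H)|`. -/
theorem max_DD2_three_approx {V : Type} [Fintype V] [Nonempty V]
    (G H Hstar : SimpleGraph V)
    (hG : IsDD2 G)
    (hSle : Hstar ≤ G) (hSmin : MinimalDD2 Hstar)
    (hopt : ∀ H' : SimpleGraph V, H' ≤ G → MinimalDD2 H' →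
      H'.edgeSet.ncard ≤ Hstar.edgeSet.ncard)
    (hHle : H ≤ G) (hHmin : MinimalDD2 H) :
    Hstar.edgeSet.ncard < 2 * Fintype.card V ∧
    Hstar.edgeSet.ncard < 3 * H.edgeSet.ncard := by
  have hlt := hSmin.ncard_edgeSet_lt
  exact ⟨hlt, hlt.trans_le hHmin.1.two_mul_card_le⟩
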